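/- arXiv:2107.06371 — 2 statements merged into one kernel-verified Lean document; each statement's English description precedes it below -/
import Mathlib

section
/- Let t ≥ 1 and suppose F is a family of subsets of [n] such that |A ∩ B| ≥ t for all A, B ∈ F. If n + t is even, then |F| ≤ Σ_{i ≥ (n+t)/2} C(n, i); if n + t is odd, then |F| ≤ C(n-1, (n+t-1)/2) + Σ_{i ≥ (n+t+1)/2} C(n, i). -/
def KatTInt (t : ℕ) (F : Finset (Finset ℕ)) : Prop := ∀ A ∈ F, ∀ B ∈ F, t ≤ (A ∩ B).card

def KatK : ℕ → ℕ → ℕ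
  | n, 0 => 2 ^ n
  | 0, _ + 1 => 0
  | n + 1, 1 => 2 ^ n
  | n + 1, t + 2 => KatK n (t + 1) + KatK n (t + 3)

def katShift (x i : ℕ) (F : Finset (Finset ℕ)) (A : Finset ℕ) : Finset ℕ :=
  if i ∈ A ∧ x ∉ A ∧ insert x (A.erase i) ∉ F then insert x (A.erase i) else A

theorem katShift_inj (x i : ℕ) (F : Finset (Finset ℕ)) : Set.InjOn (katShift x i F) F := by
  intro A hA B hB h
  simp only [Finset.mem_coe] at hA hB
  unfold katShift at h
  split_ifs at h with h1 h2 h2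
  · ext y
    have := Finset.ext_iff.1 h y
    simp only [Finset.mem_insert, Finset.mem_erase] at this
    by_cases hy : y = x
    · subst hy; simp [h1.2.1, h2.2.1]
    · by_cases hi : y = i
      · subst hi; simp [h1.1, h2.1]
      · simpa [hy, hi] using this
  · exact absurd (h ▸ hB) h1.2.2
  · exact absurd (h ▸ hA) h2.2.2
  · exact h

theorem kat_mixed (x i t : ℕ) (F : Finset (Finset ℕ)) (hF : KatTInt t F) (A B : Finset ℕ)
    (hA : A ∈ F) (hB : B ∈ F) (h1 : i ∈ A ∧ x ∉ A ∧ insert x (A.erase i) ∉ F)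
    (h2 : ¬ (i ∈ B ∧ x ∉ B ∧ insert x (B.erase i) ∉ F)) :
    t ≤ (insert x (A.erase i) ∩ B).card := by
  have hAB := hF A hA B hB
  by_cases hx : x ∈ B
  · have : insert x (A.erase i) ∩ B = insert x ((A ∩ B).erase i) := by
      ext y; simp only [Finset.mem_inter, Finset.mem_insert, Finset.mem_erase]; grind
    rw [this, Finset.card_insert_of_notMem (by simp [h1.2.1])]
    have := Finset.pred_card_le_card_erase (s := A ∩ B) (a := i)
    omega
  · by_cases hi : i ∈ B
    · have hB' : insert x (B.erase i) ∈ F := by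
        by_contra h; exact h2 ⟨hi, hx, h⟩
      have := hF A hA _ hB'
      refine this.trans (Finset.card_le_card ?_)
      intro y; simp only [Finset.mem_inter, Finset.mem_insert, Finset.mem_erase]; grind
    · refine hAB.trans (Finset.card_le_card ?_)
      intro y; simp only [Finset.mem_inter, Finset.mem_insert, Finset.mem_erase]; grind

theorem katShift_int (x i t : ℕ) (F : Finset (Finset ℕ)) (hF : KatTInt t F) :
    KatTInt t (F.image (katShift x i F)) := by
  intro A' hA' B' hB'
  obtain ⟨A, hA, rfl⟩ := Finset.mem_image.1 hA'
  obtain ⟨B, hB, rfl⟩ := Finset.mem_image.1 hB'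
  unfold katShift
  split_ifs with h1 h2 h2
  · have : insert x (A.erase i) ∩ insert x (B.erase i) = insert x ((A ∩ B).erase i) := by
      ext y; simp only [Finset.mem_inter, Finset.mem_insert, Finset.mem_erase]; grind
    rw [this, Finset.card_insert_of_notMem (by simp [h1.2.1])]
    have := Finset.pred_card_le_card_erase (s := A ∩ B) (a := i)
    have := hF A hA B hB
    omega
  · exact kat_mixed x i t F hF A B hA hB h1 h2
  · rw [Finset.inter_comm]
    exact kat_mixed x i t F hF B A hB hA h2 h1
  · exact hF A hA B hB

theorem kat_stable (x t : ℕ) (S : Finset ℕ) (hx : x ∈ S) (m : ℕ) :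
    ∀ F : Finset (Finset ℕ), (∀ A ∈ F, A ⊆ S) → KatTInt t F →
      (F.filter (fun A => x ∉ A)).card = m →
      ∃ G : Finset (Finset ℕ), G.card = F.card ∧ (∀ A ∈ G, A ⊆ S) ∧ KatTInt t G ∧
        ∀ A ∈ G, ∀ i ∈ A, x ∉ A → insert x (A.erase i) ∈ G := by
  induction m using Nat.strong_induction_on with
  | _ m ih =>
    intro F hS hF hm
    by_cases hst : ∀ A ∈ F, ∀ i ∈ A, x ∉ A → insert x (A.erase i) ∈ F
    · exact ⟨F, rfl, hS, hF, hst⟩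
    push Not at hst
    obtain ⟨A, hA, i, hi, hxA, hn⟩ := hst
    have hlt : ((F.image (katShift x i F)).filter (fun A => x ∉ A)).card < m := by
      rw [← hm]
      apply Finset.card_lt_card
      rw [Finset.ssubset_iff_of_subset]
      · refine ⟨A, by simp [hA, hxA], ?_⟩
        simp only [Finset.mem_filter, Finset.mem_image, not_and]
        rintro ⟨B, hB, hBA⟩
        exfalso
        unfold katShift at hBA
        split_ifs at hBA with h
        · exact h.2.2 (hBA ▸ hA)
        · subst hBA; exact h ⟨hi, hxA, hn⟩
      · intro C hC
        simp only [Finset.mem_filter, Finset.mem_image] at hC ⊢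
        obtain ⟨⟨B, hB, hBC⟩, hxC⟩ := hC
        unfold katShift at hBC
        split_ifs at hBC with h
        · subst hBC; simp at hxC
        · subst hBC; exact ⟨hB, hxC⟩
    obtain ⟨G, h1, h2, h3, h4⟩ := ih _ hlt (F.image (katShift x i F)) (by
      intro C hC
      obtain ⟨B, hB, rfl⟩ := Finset.mem_image.1 hC
      unfold katShift
      split_ifs
      · exact Finset.insert_subset hx ((Finset.erase_subset _ _).trans (hS B hB))
      · exact hS B hB) (katShift_int x i t F hF) rfl
    exact ⟨G, h1.trans (Finset.card_image_of_injOn (katShift_inj x i F)), h2, h3, h4⟩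

theorem kat_one (S : Finset ℕ) (F : Finset (Finset ℕ)) (hS : ∀ A ∈ F, A ⊆ S)
    (hF : KatTInt 1 F) : 2 * F.card ≤ 2 ^ S.card := by
  have hinj : Set.InjOn (fun A => S \ A) (F : Set (Finset ℕ)) := by
    intro A hA B hB h
    have := congrArg (fun C => S \ C) h
    simpa [Finset.inter_eq_right.2 (hS A hA), Finset.inter_eq_right.2 (hS B hB)] using this
  have hd : Disjoint F (F.image (fun A => S \ A)) := by
    rw [Finset.disjoint_left]
    intro A hA hA'
    obtain ⟨B, hB, rfl⟩ := Finset.mem_image.1 hA'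
    have := hF _ hA _ hB
    simp at this
  have hsub : F ∪ F.image (fun A => S \ A) ⊆ S.powerset := by
    intro A hA
    rw [Finset.mem_powerset]
    rcases Finset.mem_union.1 hA with h | h
    · exact hS A h
    · obtain ⟨B, hB, rfl⟩ := Finset.mem_image.1 h
      exact Finset.sdiff_subset
  have := Finset.card_le_card hsub
  rw [Finset.card_union_of_disjoint hd, Finset.card_image_of_injOn hinj,
    Finset.card_powerset] at this
  omega

theorem kat_main (n : ℕ) : ∀ (t : ℕ) (S : Finset ℕ) (F : Finset (Finset ℕ)), S.card = n →
    (∀ A ∈ F, A ⊆ S) → KatTInt t F → F.card ≤ KatK n t := by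
  induction n with
  | zero =>
    intro t S F hn hS hF
    have h0 : S = ∅ := Finset.card_eq_zero.1 hn
    subst h0
    match t with
    | 0 =>
      have : F ⊆ (∅ : Finset ℕ).powerset := fun A hA => Finset.mem_powerset.2 (hS A hA)
      simpa [KatK] using Finset.card_le_card this
    | t + 1 =>
      have : F = ∅ := by
        rw [Finset.eq_empty_iff_forall_notMem]
        intro A hA
        have h := hF A hA A hA
        have := Finset.subset_empty.1 (hS A hA)
        subst this
        simp at h
      simp [this]
  | succ n ih =>
    intro t S F hn hS hF
    match t with
    | 0 =>
      have : F ⊆ S.powerset := fun A hA => Finset.mem_powerset.2 (hS A hA)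
      have := Finset.card_le_card this
      rw [Finset.card_powerset, hn] at this
      simpa [KatK] using this
    | 1 =>
      have := kat_one S F hS hF
      rw [hn, pow_succ] at this
      simp only [KatK]; omega
    | t + 2 =>
      obtain ⟨x, hx⟩ : S.Nonempty := Finset.card_pos.1 (by omega)
      obtain ⟨G, h1, h2, h3, h4⟩ := kat_stable x (t+2) S hx _ F hS hF rfl
      have hc : (S.erase x).card = n := by rw [Finset.card_erase_of_mem hx, hn]; rfl
      rw [← h1, ← Finset.card_memberSubfamily_add_card_nonMemberSubfamily x G]
      simp only [KatK]
      refine add_le_add (ih (t+1) (S.erase x) _ hc ?_ ?_) (ih (t+3) (S.erase x) _ hc ?_ ?_)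
      · intro A hA
        rw [Finset.mem_memberSubfamily] at hA
        intro y hy
        rw [Finset.mem_erase]
        exact ⟨fun h => hA.2 (h ▸ hy), h2 _ hA.1 (Finset.mem_insert_of_mem hy)⟩
      · intro A hA B hB
        rw [Finset.mem_memberSubfamily] at hA hB
        have := h3 _ hA.1 _ hB.1
        rw [← Finset.insert_inter_distrib, Finset.card_insert_of_notMem (by simp [hA.2])] at this
        omega
      · intro A hA
        rw [Finset.mem_nonMemberSubfamily] at hA
        intro y hy
        rw [Finset.mem_erase]
        exact ⟨fun h => hA.2 (h ▸ hy), h2 _ hA.1 hy⟩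
      · intro A hA B hB
        rw [Finset.mem_nonMemberSubfamily] at hA hB
        have hAB := h3 _ hA.1 _ hB.1
        obtain ⟨i, hi⟩ : (A ∩ B).Nonempty := Finset.card_pos.1 (by omega)
        have hi' := Finset.mem_inter.1 hi
        have h5 := h3 _ (h4 A hA.1 i hi'.1 hA.2) _ hB.1
        have : insert x (A.erase i) ∩ B = (A ∩ B).erase i := by
          ext y; simp only [Finset.mem_inter, Finset.mem_insert, Finset.mem_erase]; grind
        rw [this, Finset.card_erase_of_mem hi] at h5
        omega

def KatT (n m : ℕ) : ℕ := ∑ i ∈ Finset.Icc m n, n.choose i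

theorem katT_step (n m : ℕ) : KatT n m = n.choose m + KatT n (m + 1) := by
  unfold KatT
  by_cases h : m ≤ n
  · have : Finset.Icc (m + 1) n = Finset.Ioc m n := by
      ext; simp only [Finset.mem_Icc, Finset.mem_Ioc]; omega
    rw [← Finset.add_sum_Ioc_eq_sum_Icc h, this]
  · rw [Finset.Icc_eq_empty (by omega), Finset.Icc_eq_empty (by omega),
      Nat.choose_eq_zero_of_lt (by omega)]; rfl

theorem katT_big (n m : ℕ) (h : n < m) : KatT n m = 0 := by
  unfold KatT
  rw [Finset.Icc_eq_empty (by omega)]; rfl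

theorem katT_pascal (n m : ℕ) : KatT (n + 1) (m + 1) = KatT n m + KatT n (m + 1) := by
  by_cases h : n < m
  · rw [katT_big _ _ (by omega), katT_big _ _ h, katT_big _ _ (by omega)]
  · obtain ⟨d, hd⟩ : ∃ d, d = n + 1 - m := ⟨_, rfl⟩
    induction d generalizing m with
    | zero => omega
    | succ d ih =>
      by_cases h' : n < m + 1
      · have : n = m := by omega
        subst this
        rw [katT_step (n+1), katT_big (n+1) _ (by omega), katT_step n n, katT_big n _ (by omega)]
        simp
      · rw [katT_step (n+1), ih (m+1) h' (by omega), Nat.choose_succ_succ, katT_step n m,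
          katT_step n (m+1)]
        ring

theorem katT_zero (n : ℕ) : KatT n 0 = 2 ^ n := by
  unfold KatT
  rw [← Nat.sum_range_choose, Finset.range_eq_Ico]; rfl

/-- odd total: n = 2k+1, tail from k+1 -/
theorem katT_half (k : ℕ) : KatT (2 * k + 1) (k + 1) = 2 ^ (2 * k) := by
  have h : KatT (2*k+1) 0 = ∑ i ∈ Finset.range (k+1), (2*k+1).choose i + KatT (2*k+1) (k+1) := by
    unfold KatT
    have : Finset.Icc 0 (2*k+1) = Finset.range (2*k+2) := by
      ext; simp; omega
    have h2 : Finset.Icc (k+1) (2*k+1) = Finset.Ico (k+1) (2*k+2) := by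
      ext; simp only [Finset.mem_Icc, Finset.mem_Ico]; omega
    rw [this, h2, Finset.range_eq_Ico, ← Finset.sum_Ico_consecutive _ (Nat.zero_le (k+1)) (by omega : k+1 ≤ 2*k+2),
      ← Finset.range_eq_Ico]
  rw [katT_zero, Nat.sum_range_choose_halfway, pow_succ] at h
  have : (4:ℕ)^k = 2^(2*k) := by rw [pow_mul]; norm_num
  omega

theorem katK_big (n : ℕ) : ∀ t, n < t → KatK n t = 0 := by
  induction n with
  | zero => intro t ht; match t with | t+1 => simp [KatK]
  | succ n ih =>
    intro t ht
    match t with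
    | t+2 => simp only [KatK]; rw [ih _ (by omega), ih _ (by omega)]

theorem katK_even (n : ℕ) : ∀ t m, 1 ≤ t → n + t = 2 * m → KatK n t = KatT n m := by
  induction n with
  | zero =>
    intro t m ht h
    rw [katK_big _ _ (by omega), katT_big _ _ (by omega)]
  | succ n ih =>
    intro t m ht h
    match t with
    | 1 =>
      obtain ⟨k, rfl⟩ : ∃ k, m = k + 1 := ⟨m - 1, by omega⟩
      obtain rfl : n = 2 * k := by omega
      rw [katT_half]; simp [KatK]
    | t+2 =>
      obtain ⟨k, rfl⟩ : ∃ k, m = k + 1 := ⟨m - 1, by omega⟩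
      simp only [KatK]
      rw [katT_pascal, ih (t+1) k (by omega) (by omega), ih (t+3) (k+1) (by omega) (by omega)]

theorem katK_odd (n : ℕ) : ∀ t m, 1 ≤ t → n + 1 + t = 2 * m + 1 →
    KatK (n + 1) t = n.choose m + KatT (n + 1) (m + 1) := by
  induction n with
  | zero =>
    intro t m ht h
    rw [katK_big _ _ (by omega), katT_big _ _ (by omega), Nat.choose_eq_zero_of_lt (by omega)]
  | succ n ih =>
    intro t m ht h
    obtain ⟨k, rfl⟩ : ∃ k, m = k + 1 := ⟨m - 1, by omega⟩
    match t with
    | 1 =>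
      obtain rfl : n = 2 * k := by omega
      have h1 := katT_pascal (2 * k + 1) (k + 1)
      have h2 := katT_step (2 * k + 1) (k + 1)
      have h3 := katT_half k
      rw [h1]
      simp only [KatK, pow_succ]
      omega
    | t+2 =>
      have h1 := ih (t + 1) k (by omega) (by omega)
      have h2 := ih (t + 3) (k + 1) (by omega) (by omega)
      rw [KatK, h1, h2, katT_pascal (n + 1) (k + 1), Nat.choose_succ_succ']
      ring

theorem stmt_6 (n t : ℕ) (ht : 1 ≤ t) (F : Finset (Finset (Fin n)))
    (hF : ∀ A ∈ F, ∀ B ∈ F, t ≤ (A ∩ B).card) :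
    (Even (n + t) → F.card ≤ ∑ i ∈ Finset.Icc ((n + t) / 2) n, n.choose i) ∧
    (Odd (n + t) → F.card ≤
      (n - 1).choose ((n + t - 1) / 2) + ∑ i ∈ Finset.Icc ((n + t + 1) / 2) n, n.choose i) := by
  have key : F.card ≤ KatK n t := by
    have := kat_main n t (Finset.range n) (F.image (fun A => A.map Fin.valEmbedding))
      (by simp) ?_ ?_
    · rwa [Finset.card_image_of_injective _ (Finset.map_injective _)] at this
    · intro A hA
      obtain ⟨B, hB, rfl⟩ := Finset.mem_image.1 hA
      intro y hy
      obtain ⟨z, _, rfl⟩ := Finset.mem_map.1 hy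
      simp
    · intro A hA B hB
      obtain ⟨A, hA', rfl⟩ := Finset.mem_image.1 hA
      obtain ⟨B, hB', rfl⟩ := Finset.mem_image.1 hB
      rw [← Finset.map_inter, Finset.card_map]
      exact hF A hA' B hB'
  constructor
  · rintro ⟨m, hm⟩
    have h := katK_even n t m ht (by omega)
    have : (n + t) / 2 = m := by omega
    rw [this]
    exact key.trans h.le
  · rintro ⟨m, hm⟩
    match n with
    | 0 =>
      rw [katK_big 0 t (by omega)] at key
      omega
    | n + 1 =>
      have h := katK_odd n t m ht (by omega)
      have h1 : (n + 1 + t - 1) / 2 = m := by omega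
      have h2 : (n + 1 + t + 1) / 2 = m + 1 := by omega
      rw [h1, h2]
      exact key.trans h.le
end

section
/- Let n ≥ 1 and let F be a family of (edge-sets of) labelled graphs on vertex set [n] such that any two graphs in F share at least one edge. Suppose additionally that for every bipartition [n] = T ∪ ([n]\T), the projections {F ∩ (binom(T,2) ∪ binom([n]\T,2)) : F ∈ F} are intersecting whenever F is triangle-intersecting. Then if F is triangle-intersecting, |F| ≤ 2^{C(n,2) - 2}. -/
/-- A family of graphs on `[n]` (each graph identified with its edge-set, a set of
2-element subsets of `Fin n`) is triangle-intersecting if any two of its members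
share a triangle. -/
def TriangleIntersecting (n : ℕ) (F : Finset (Finset (Finset (Fin n)))) : Prop :=
  ∀ G ∈ F, ∀ H ∈ F, ∃ a b c : Fin n, a ≠ b ∧ a ≠ c ∧ b ≠ c ∧
    ({a, b} : Finset (Fin n)) ∈ G ∩ H ∧
    ({a, c} : Finset (Fin n)) ∈ G ∩ H ∧
    ({b, c} : Finset (Fin n)) ∈ G ∩ H

/-- The edges lying within one side of the bipartition `(T, [n] \ T)`. -/
def sameSideEdges (n : ℕ) (T : Finset (Fin n)) : Finset (Finset (Fin n)) :=
  (Finset.powersetCard 2 (Finset.univ : Finset (Fin n))).filter (fun e => e ⊆ T ∨ e ⊆ Tᶜ)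

open Finset in
theorem aux_holder {ι : Type*} (s : Finset ι) (a b : ι → ℝ) (ha : ∀ i ∈ s, 0 ≤ a i)
    (hb : ∀ i ∈ s, 0 ≤ b i) (A x y : ℝ) (hA : 0 ≤ A) (hx : 0 ≤ x) (hy : 0 ≤ y)
    (k : ℕ) (hk : 1 ≤ k) (hs : s.card = k)
    (h1 : x ^ k ≤ A * ∏ i ∈ s, a i) (h2 : y ^ k ≤ A * ∏ i ∈ s, b i) :
    (x + y) ^ k ≤ A * ∏ i ∈ s, (a i + b i) := by
  have hk0 : k ≠ 0 := by omega
  have hkr : (0:ℝ) < k := by exact_mod_cast hk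
  by_cases hz : ∃ i ∈ s, a i + b i = 0
  · obtain ⟨i, hi, hi0⟩ := hz
    have hai : a i = 0 := by linarith [ha i hi, hb i hi]
    have hbi : b i = 0 := by linarith [ha i hi, hb i hi]
    rw [prod_eq_zero hi hai] at h1
    rw [prod_eq_zero hi hbi] at h2
    rw [prod_eq_zero hi hi0]
    have hx0 : x = 0 := by
      have : x ^ k = 0 := le_antisymm (by simpa using h1) (by positivity)
      exact pow_eq_zero_iff hk0 |>.1 this
    have hy0 : y = 0 := by
      have : y ^ k = 0 := le_antisymm (by simpa using h2) (by positivity)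
      exact pow_eq_zero_iff hk0 |>.1 this
    simp [hx0, hy0, hk0]
  push Not at hz
  have hpos : ∀ i ∈ s, 0 < a i + b i := fun i hi =>
    lt_of_le_of_ne (by linarith [ha i hi, hb i hi]) (Ne.symm (hz i hi))
  have hP : 0 < ∏ i ∈ s, (a i + b i) := prod_pos hpos
  set P := ∏ i ∈ s, (a i + b i) with hPdef
  set C := (A * P) ^ ((k:ℝ)⁻¹) with hC
  have hC0 : 0 ≤ C := by positivity
  have hCk : C ^ k = A * P := Real.rpow_inv_natCast_pow (by positivity) hk0
  have key : ∀ (c : ι → ℝ) (z : ℝ), (∀ i ∈ s, 0 ≤ c i) → 0 ≤ z → z ^ k ≤ A * ∏ i ∈ s, c i →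
      z ≤ C * ∑ i ∈ s, (k:ℝ)⁻¹ * (c i / (a i + b i)) := by
    intro c z hc hz0 hzk
    have hq : ∀ i ∈ s, 0 ≤ c i / (a i + b i) := fun i hi => div_nonneg (hc i hi) (hpos i hi).le
    have amgm := Real.geom_mean_le_arith_mean_weighted s (fun _ => (k:ℝ)⁻¹)
      (fun i => c i / (a i + b i)) (fun _ _ => by positivity)
      (by simp [hs, hkr.ne']) hq
    refine le_trans ?_ (mul_le_mul_of_nonneg_left amgm hC0)
    rw [Real.finsetProd_rpow s _ hq, hC, ← Real.mul_rpow (by positivity) (prod_nonneg hq)]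
    have : A * P * ∏ i ∈ s, c i / (a i + b i) = A * ∏ i ∈ s, c i := by
      rw [prod_div_distrib, ← hPdef]; field_simp
    rw [this]
    have hn : 0 ≤ A * ∏ i ∈ s, c i := mul_nonneg hA (prod_nonneg hc)
    refine (pow_le_pow_iff_left₀ hz0 (by positivity) hk0).1 ?_
    rw [Real.rpow_inv_natCast_pow hn hk0]; exact hzk
  have k1 := key a x ha hx h1
  have k2 := key b y hb hy h2
  have hsum : ∑ i ∈ s, (k:ℝ)⁻¹ * (a i / (a i + b i)) + ∑ i ∈ s, (k:ℝ)⁻¹ * (b i / (a i + b i)) = 1 := by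
    rw [← sum_add_distrib]
    have : ∀ i ∈ s, (k:ℝ)⁻¹ * (a i / (a i + b i)) + (k:ℝ)⁻¹ * (b i / (a i + b i)) = (k:ℝ)⁻¹ := by
      intro i hi
      have := (hpos i hi).ne'
      rw [← mul_add, ← add_div, div_self this, mul_one]
    rw [sum_congr rfl this]; simp [hs, hkr.ne']
  have : x + y ≤ C := by
    calc x + y ≤ _ := add_le_add k1 k2
      _ = C := by rw [← mul_add, hsum, mul_one]
  rw [← hCk]
  exact pow_le_pow_left₀ (by positivity) this k

open Finset in
theorem aux_shearer {α ι : Type*} [DecidableEq α] [DecidableEq ι] (I : Finset ι)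
    (S : ι → Finset α) (k : ℕ) (hk : 1 ≤ k) (E : Finset α) :
    ∀ (F : Finset (Finset α)), (∀ A ∈ F, A ⊆ E) →
    (∀ e ∈ E, (I.filter (fun i => e ∈ S i)).card = k) →
    F.card ^ k ≤ ∏ i ∈ I, (F.image (fun A => A ∩ S i)).card := by
  induction E using Finset.induction_on with
  | empty =>
    intro F hF _
    rcases F.eq_empty_or_nonempty with rfl | hne
    · simp [show k ≠ 0 by omega]
    · have h1 : F.card ≤ 1 := card_le_one.2 fun A hA B hB => by
        rw [subset_empty.1 (hF A hA), subset_empty.1 (hF B hB)]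
      calc F.card ^ k ≤ 1 ^ k := Nat.pow_le_pow_left h1 k
        _ = 1 := one_pow k
        _ ≤ _ := Nat.one_le_iff_ne_zero.2 (prod_ne_zero_iff.2 fun i _ => by
            simpa using hne.ne_empty)
  | insert e E he ih =>
    intro F hF hcov
    have hcov' : ∀ e ∈ E, (I.filter (fun i => e ∈ S i)).card = k :=
      fun x hx => hcov x (mem_insert_of_mem hx)
    have ih0 := ih (F.nonMemberSubfamily e) (by
      intro A hA x hx
      rw [mem_nonMemberSubfamily] at hA
      rcases mem_insert.1 (hF A hA.1 hx) with rfl | h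
      · exact absurd hx hA.2
      · exact h) hcov'
    have ih1 := ih (F.memberSubfamily e) (by
      intro A hA x hx
      rw [mem_memberSubfamily] at hA
      rcases mem_insert.1 (hF _ hA.1 (mem_insert_of_mem hx)) with rfl | h
      · exact absurd hx hA.2
      · exact h) hcov'
    have hcard := card_memberSubfamily_add_card_nonMemberSubfamily e F
    let p : ι → Finset (Finset α) → ℕ := fun i G => (G.image (fun A => A ∩ S i)).card
    have hin : ∀ i ∈ I.filter (fun i => e ∈ S i),
        p i (F.memberSubfamily e) + p i (F.nonMemberSubfamily e) ≤ p i F := by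
      intro i hi
      have hei := (mem_filter.1 hi).2
      have := card_memberSubfamily_add_card_nonMemberSubfamily e (F.image (fun A => A ∩ S i))
      simp only [p]
      rw [← this]
      refine add_le_add (card_le_card ?_) (card_le_card ?_)
      · intro B hB
        obtain ⟨A, hA, rfl⟩ := mem_image.1 hB
        rw [mem_memberSubfamily] at hA ⊢
        refine ⟨mem_image.2 ⟨insert e A, hA.1, ?_⟩, fun h => hA.2 (mem_inter.1 h).1⟩
        exact insert_inter_of_mem hei
      · intro B hB
        obtain ⟨A, hA, rfl⟩ := mem_image.1 hB
        rw [mem_nonMemberSubfamily] at hA ⊢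
        exact ⟨mem_image.2 ⟨A, hA.1, rfl⟩, fun h => hA.2 (mem_inter.1 h).1⟩
    have hout1 : ∀ i ∈ I.filter (fun i => ¬ e ∈ S i), p i (F.memberSubfamily e) ≤ p i F := by
      intro i hi
      have hei := (mem_filter.1 hi).2
      refine card_le_card ?_
      intro B hB
      obtain ⟨A, hA, rfl⟩ := mem_image.1 hB
      rw [mem_memberSubfamily] at hA
      exact mem_image.2 ⟨insert e A, hA.1, insert_inter_of_notMem hei⟩
    have hout0 : ∀ i ∈ I.filter (fun i => ¬ e ∈ S i), p i (F.nonMemberSubfamily e) ≤ p i F := by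
      intro i hi
      refine card_le_card (image_subset_image ?_)
      exact filter_subset _ _
    change _ ≤ ∏ i ∈ I, p i _ at ih0
    change _ ≤ ∏ i ∈ I, p i _ at ih1
    change _ ≤ ∏ i ∈ I, p i _
    rw [← prod_filter_mul_prod_filter_not I (fun i => e ∈ S i), mul_comm] at ih0 ih1 ⊢
    have g0 := ih0.trans (Nat.mul_le_mul_right _ (prod_le_prod' hout0))
    have g1 := ih1.trans (Nat.mul_le_mul_right _ (prod_le_prod' hout1))
    clear_value p
    have := aux_holder (I.filter (fun i => e ∈ S i)) (fun i => (p i (F.memberSubfamily e) : ℝ))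
      (fun i => (p i (F.nonMemberSubfamily e) : ℝ)) (fun _ _ => by positivity)
      (fun _ _ => by positivity) ((∏ i ∈ I.filter (fun i => ¬ e ∈ S i), p i F : ℕ) : ℝ)
      ((F.memberSubfamily e).card : ℝ) ((F.nonMemberSubfamily e).card : ℝ)
      (by positivity) (by positivity) (by positivity) k hk (hcov e (mem_insert_self _ _))
      (by rw [← Nat.cast_prod]; exact_mod_cast g1) (by rw [← Nat.cast_prod]; exact_mod_cast g0)
    rw [← hcard]
    refine le_trans (b := (∏ i ∈ I.filter (fun i => ¬ e ∈ S i), p i F) * ∏ i ∈ I.filter (fun i => e ∈ S i),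
      (p i (F.memberSubfamily e) + p i (F.nonMemberSubfamily e))) (by exact_mod_cast this) ?_
    exact Nat.mul_le_mul_left _ (prod_le_prod' hin)

open Finset in
theorem aux_inter {α : Type*} [DecidableEq α] (S : Finset α) (P : Finset (Finset α))
    (hP : ∀ A ∈ P, A ⊆ S) (hi : ∀ A ∈ P, ∀ B ∈ P, (A ∩ B).Nonempty) :
    2 * P.card ≤ 2 ^ S.card := by
  have hc : (P.image (fun A => S \ A)).card = P.card := by
    refine card_image_of_injOn ?_
    intro A hA B hB h
    have h' : S \ A = S \ B := h
    rw [← Finset.sdiff_sdiff_eq_self (hP A hA), ← Finset.sdiff_sdiff_eq_self (hP B hB), h']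
  have hd : Disjoint P (P.image (fun A => S \ A)) := by
    rw [disjoint_left]
    intro A hA hA'
    obtain ⟨B, hB, rfl⟩ := mem_image.1 hA'
    obtain ⟨x, hx⟩ := hi _ hA _ hB
    simp at hx
  rw [two_mul]
  nth_rewrite 2 [← hc]
  rw [← card_union_of_disjoint hd, ← card_powerset]
  refine card_le_card (union_subset (fun A hA => mem_powerset.2 (hP A hA)) ?_)
  intro A hA
  obtain ⟨B, hB, rfl⟩ := mem_image.1 hA
  exact mem_powerset.2 sdiff_subset

open Finset in
theorem aux_cover (n : ℕ) (hn : 1 ≤ n) (e : Finset (Fin n))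
    (he : e ∈ powersetCard 2 (univ : Finset (Fin n))) :
    ((univ : Finset (Finset (Fin n))).filter (fun T => e ∈ sameSideEdges n T)).card
      = 2 ^ (n - 1) := by
  have he2 := (mem_powersetCard.1 he).2
  obtain ⟨a, b, hab, rfl⟩ := card_eq_two.1 he2
  have hiff : ∀ T : Finset (Fin n), {a, b} ∈ sameSideEdges n T ↔ (a ∈ T ↔ b ∈ T) := by
    intro T
    simp only [sameSideEdges, mem_filter, he, true_and, insert_subset_iff, singleton_subset_iff,
      mem_compl]
    tauto
  simp only [hiff]
  have htot := card_filter_add_card_filter_not (s := (univ : Finset (Finset (Fin n))))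
    (fun T => a ∈ T ↔ b ∈ T)
  have hbij : ((univ : Finset (Finset (Fin n))).filter (fun T => a ∈ T ↔ b ∈ T)).card =
      ((univ : Finset (Finset (Fin n))).filter (fun T => ¬ (a ∈ T ↔ b ∈ T))).card := by
    refine card_bij' (fun T _ => symmDiff T {a}) (fun T _ => symmDiff T {a}) ?_ ?_ ?_ ?_
    · intro T hT
      have := hab.symm
      simp [mem_symmDiff, this] at hT ⊢
      tauto
    · intro T hT
      have := hab.symm
      simp [mem_symmDiff, this] at hT ⊢
      tauto
    · intro T _; simp [symmDiff_symmDiff_cancel_right]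
    · intro T _; simp [symmDiff_symmDiff_cancel_right]
  have hu : (univ : Finset (Finset (Fin n))).card = 2 ^ n := by simp
  obtain ⟨m, rfl⟩ : ∃ m, n = m + 1 := ⟨n - 1, by omega⟩
  rw [hu, pow_succ] at htot
  simp only [Nat.add_sub_cancel]
  omega

open Finset in
theorem aux_sum (n : ℕ) (hn : 1 ≤ n) :
    ∑ T : Finset (Fin n), (sameSideEdges n T).card = n.choose 2 * 2 ^ (n - 1) := by
  have h := sum_card_bipartiteAbove_eq_sum_card_bipartiteBelow
    (s := (univ : Finset (Finset (Fin n)))) (t := powersetCard 2 (univ : Finset (Fin n)))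
    (fun T e => e ∈ sameSideEdges n T)
  have h1 : ∀ T : Finset (Fin n), bipartiteAbove (fun T e => e ∈ sameSideEdges n T)
      (powersetCard 2 (univ : Finset (Fin n))) T = sameSideEdges n T := by
    intro T
    ext e
    simp only [bipartiteAbove, mem_filter, sameSideEdges]
    tauto
  simp only [h1] at h
  simp only [bipartiteBelow] at h
  rw [h, sum_congr rfl (fun e he => aux_cover n hn e he)]
  simp

theorem stmt_16 (n : ℕ) (hn : 1 ≤ n) (F : Finset (Finset (Finset (Fin n))))
    (hEdges : ∀ G ∈ F, G ⊆ Finset.powersetCard 2 (Finset.univ : Finset (Fin n)))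
    (hShareEdge : ∀ G ∈ F, ∀ H ∈ F, (G ∩ H).Nonempty)
    (hProj : TriangleIntersecting n F → ∀ T : Finset (Fin n),
        ∀ G ∈ F, ∀ H ∈ F, (G ∩ H ∩ sameSideEdges n T).Nonempty) :
    TriangleIntersecting n F → F.card ≤ 2 ^ (n.choose 2 - 2) := by
  intro hT
  have hp := hProj hT
  have hsh := aux_shearer (Finset.univ : Finset (Finset (Fin n))) (sameSideEdges n)
    (2 ^ (n - 1)) Nat.one_le_two_pow _ F hEdges (aux_cover n hn)
  have hb : ∀ T : Finset (Fin n),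
      2 * (F.image (fun A => A ∩ sameSideEdges n T)).card ≤ 2 ^ (sameSideEdges n T).card := by
    intro T
    apply aux_inter
    · intro A hA
      obtain ⟨G, _, rfl⟩ := Finset.mem_image.1 hA
      exact Finset.inter_subset_right
    · intro A hA B hB
      obtain ⟨G, hG, rfl⟩ := Finset.mem_image.1 hA
      obtain ⟨H, hH, rfl⟩ := Finset.mem_image.1 hB
      obtain ⟨x, hx⟩ := hp T G hG H hH
      simp only [Finset.mem_inter] at hx
      exact ⟨x, by simp only [Finset.mem_inter]; tauto⟩
  have hprod := Finset.prod_le_prod' (s := (Finset.univ : Finset (Finset (Fin n))))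
    (fun T _ => hb T)
  rw [Finset.prod_mul_distrib, Finset.prod_pow_eq_pow_sum, aux_sum n hn, Finset.prod_const,
    Finset.card_univ, Fintype.card_finset, Fintype.card_fin] at hprod
  have h4 : (4 * F.card) ^ (2 ^ (n - 1)) ≤ (2 ^ n.choose 2) ^ (2 ^ (n - 1)) := by
    have h2n : 2 ^ n = 2 * 2 ^ (n - 1) := by
      obtain ⟨m, rfl⟩ : ∃ m, n = m + 1 := ⟨n - 1, by omega⟩
      simp [pow_succ, mul_comm]
    rw [h2n, pow_mul 2 2] at hprod
    rw [mul_pow, ← pow_mul]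
    exact (Nat.mul_le_mul_left _ hsh).trans hprod
  have h5 : 4 * F.card ≤ 2 ^ n.choose 2 :=
    (Nat.pow_le_pow_iff_left (by positivity)).1 h4
  rcases Nat.lt_or_ge (n.choose 2) 2 with h | h
  · interval_cases h' : n.choose 2 <;> simp at h5 ⊢ <;> omega
  · obtain ⟨m, hm⟩ : ∃ m, n.choose 2 = m + 2 := ⟨n.choose 2 - 2, by omega⟩
    rw [hm, pow_add] at h5
    rw [hm, Nat.add_sub_cancel]
    omega
end
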